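/- arXiv:2205.03903 — 2 statements merged into one kernel-verified Lean document; each statement's English description precedes it below -/
import Mathlib

section
/- For any partition lambda with at most m parts, the Schur polynomial s_lambda(x_1,...,x_m) has saturated Newton polytope, and its Newton polytope equals the convex hull of the S_m-orbit of lambda, i.e., the convex hull of all coordinate permutations of lambda. -/
open Finset Pointwise

/-- The Young diagram of a partition with at most `m` parts given as an antitone map. -/
def diagramOf {m : ℕ} (lam : Fin m → ℕ) (h : Antitone lam) : YoungDiagram where
  cells := Finset.univ.biUnion fun i : Fin m =>
    (Finset.range (lam i)).image fun j => ((i : ℕ), j)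
  isLowerSet := by
    rintro ⟨i₁, j₁⟩ ⟨i₂, j₂⟩ ⟨hi, hj⟩ hm
    simp only [Finset.coe_biUnion, Finset.coe_univ, Set.mem_iUnion, Finset.mem_coe,
      Finset.mem_image, Finset.mem_range, Set.mem_univ, true_and, Set.iUnion_true] at hm ⊢
    obtain ⟨i, j, hj', hij⟩ := hm
    have hi1 : (i₁ : ℕ) = (i : ℕ) := ((Prod.mk.injEq _ _ _ _).mp hij).1.symm
    have hj1 : j₁ = j := ((Prod.mk.injEq _ _ _ _).mp hij).2.symm
    have hi2m : i₂ < m := lt_of_le_of_lt (le_of_le_of_eq hi hi1) i.isLt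
    refine ⟨⟨i₂, hi2m⟩, j₂, ?_, rfl⟩
    have : lam i ≤ lam ⟨i₂, hi2m⟩ := h (by simpa [Fin.le_def] using le_of_le_of_eq hi hi1)
    omega

/-- The content of a tableau: the number of cells with entry `e`. -/
def content (μ : YoungDiagram) (T : SemistandardYoungTableau μ) (e : ℕ) : ℕ :=
  (μ.cells.filter fun c => T c.1 c.2 = e).card

/-- The coefficient of `x^α` in the Schur polynomial `s_μ(x_1, …, x_m)`: the number of
semistandard Young tableaux of shape `μ` with entries in `{0, …, m-1}` and content `α`. -/
noncomputable def schurCoeff (m : ℕ) (μ : YoungDiagram) (α : Fin m → ℕ) : ℕ :=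
  Nat.card {T : SemistandardYoungTableau μ // (∀ i j : ℕ, (i, j) ∈ μ → T i j < m) ∧
    ∀ k : Fin m, content μ T (k : ℕ) = α k}

/-- The Schur polynomial, viewed as its coefficient function. -/
noncomputable def schurR (m : ℕ) (μ : YoungDiagram) : (Fin m → ℕ) → ℝ :=
  fun α => (schurCoeff m μ α : ℝ)

/-- The support of a polynomial (given by its coefficient function), as a set of points of `ℝ^m`. -/
def Supp {m : ℕ} (F : (Fin m → ℕ) → ℝ) : Set (Fin m → ℝ) :=
  {x | ∃ α : Fin m → ℕ, F α ≠ 0 ∧ x = fun i => (α i : ℝ)}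

/-- The Newton polytope of a polynomial. -/
def NewtonP {m : ℕ} (F : (Fin m → ℕ) → ℝ) : Set (Fin m → ℝ) :=
  convexHull ℝ (Supp F)

/-- A lattice point of `ℝ^m`. -/
def IsLattice {m : ℕ} (x : Fin m → ℝ) : Prop := ∀ i, ∃ z : ℤ, x i = z

/-- Saturated Newton polytope. -/
def HasSNP {m : ℕ} (F : (Fin m → ℕ) → ℝ) : Prop :=
  NewtonP F ∩ {x | IsLattice x} = Supp F

/-- Integer decomposition property of a subset of `ℝ^m`. -/
def HasIDP {m : ℕ} (P : Set (Fin m → ℝ)) : Prop :=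
  ∀ t : ℕ, 0 < t → ∀ p ∈ (t : ℝ) • P, IsLattice p →
    ∃ v : Fin t → (Fin m → ℝ), (∀ j, v j ∈ P ∧ IsLattice (v j)) ∧ p = ∑ j, v j

/-- `b` dominates `a`: every partial sum of `b` is at least that of `a`. -/
def Dominates {m : ℕ} (a b : Fin m → ℕ) : Prop :=
  ∀ j : Fin m, ∑ i ∈ Finset.univ.filter (· ≤ j), a i ≤ ∑ i ∈ Finset.univ.filter (· ≤ j), b i

/-- The `S_m`-orbit of a point of `ℕ^m`, as a subset of `ℝ^m`. -/
def orbitR {m : ℕ} (lam : Fin m → ℕ) : Set (Fin m → ℝ) :=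
  {x | ∃ σ : Equiv.Perm (Fin m), x = fun i => (lam (σ i) : ℝ)}

/-- Add a box to row `r`. -/
def AddBoxAt {m : ℕ} (ν : Fin m → ℕ) (r : Fin m) : Fin m → ℕ :=
  Function.update ν r (ν r + 1)

/-- `ν'` is obtained from `ν` by adding a box in the northmost row such that the result is
a partition that is at most `β`. -/
def NorthmostStep {m : ℕ} (β ν ν' : Fin m → ℕ) : Prop :=
  ∃ r : Fin m, ν' = AddBoxAt ν r ∧ Antitone ν' ∧ ν' ≤ β ∧
    ∀ r' : Fin m, r' < r → ¬ (Antitone (AddBoxAt ν r') ∧ AddBoxAt ν r' ≤ β)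

/-- Extension by zero. -/
def extz {m : ℕ} (lam : Fin m → ℕ) : ℕ → ℕ := fun i => if h : i < m then lam ⟨i, h⟩ else 0

lemma extz_fin {m : ℕ} (lam : Fin m → ℕ) (i : Fin m) : extz lam i = lam i := by
  simp [extz]

lemma extz_ge {m : ℕ} (lam : Fin m → ℕ) {i : ℕ} (hi : m ≤ i) : extz lam i = 0 := by
  simp [extz, hi]

lemma extz_anti {m : ℕ} (lam : Fin m → ℕ) (h : Antitone lam) : Antitone (extz lam) := by
  intro a b hab
  unfold extz
  split_ifs with h1 h2
  · exact h (by simpa [Fin.le_def] using hab)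
  · omega
  · omega
  · omega

lemma mem_diagramOf {m : ℕ} (lam : Fin m → ℕ) (h : Antitone lam) (i j : ℕ) :
    (i, j) ∈ diagramOf lam h ↔ j < extz lam i := by
  rw [← YoungDiagram.mem_cells]
  simp only [diagramOf, Finset.mem_biUnion, Finset.mem_univ, true_and, Finset.mem_image,
    Finset.mem_range, Prod.mk.injEq]
  constructor
  · rintro ⟨a, b, hb, rfl, rfl⟩
    rwa [extz_fin]
  · intro hj
    by_cases hi : i < m
    · refine ⟨⟨i, hi⟩, j, ?_, rfl, rfl⟩
      simpa [extz, hi] using hj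
    · rw [extz_ge lam (by omega)] at hj
      omega

lemma card_cells_filter {m : ℕ} (lam : Fin m → ℕ) (h : Antitone lam) (p : ℕ × ℕ → Prop)
    [DecidablePred p] (N : ℕ) (hN : ∀ i j, j < extz lam i → p (i, j) → i < N) :
    ((diagramOf lam h).cells.filter p).card =
      ∑ i ∈ range N, ((range (extz lam i)).filter fun j => p (i, j)).card := by
  rw [← Finset.card_sigma]
  refine Finset.card_bij' (fun c _ => ⟨c.1, c.2⟩) (fun c _ => (c.1, c.2)) ?_ ?_ ?_ ?_
  · rintro ⟨i, j⟩ hc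
    simp only [Finset.mem_filter, YoungDiagram.mem_cells, mem_diagramOf] at hc
    simp only [Finset.mem_sigma, Finset.mem_filter, Finset.mem_range]
    exact ⟨hN i j hc.1 hc.2, hc⟩
  · rintro ⟨i, j⟩ hc
    simp only [Finset.mem_sigma, Finset.mem_filter, Finset.mem_range] at hc
    simp only [Finset.mem_filter, YoungDiagram.mem_cells, mem_diagramOf]
    exact hc.2
  · intros; rfl
  · intros; rfl

lemma telesc (lam : ℕ → ℕ) (hl : Antitone lam) (k : ℕ) (hk : k ≤ lam 0) (n : ℕ) :
    (∑ i ∈ range n, (lam i - min k (lam i) + min k (lam (i + 1)))) + k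
      = (∑ i ∈ range n, lam i) + min k (lam n) := by
  induction n with
  | zero => simp [hk]
  | succ n ih =>
    rw [Finset.sum_range_succ, Finset.sum_range_succ]
    have := hl (Nat.le_succ n)
    simp only [Nat.succ_eq_add_one] at this
    omega

lemma exists_tab (m : ℕ) : ∀ (lam α : ℕ → ℕ), Antitone lam → (∀ i, m ≤ i → lam i = 0) →
    (∀ S ⊆ range m, ∑ i ∈ S, α i ≤ ∑ i ∈ range S.card, lam i) →
    (∑ i ∈ range m, α i = ∑ i ∈ range m, lam i) →
    ∃ T : ℕ → ℕ → ℕ, (∀ i j, j < lam i → T i j < m) ∧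
      (∀ i j1 j2, j1 < j2 → j2 < lam i → T i j1 ≤ T i j2) ∧
      (∀ i1 i2 j, i1 < i2 → j < lam i2 → T i1 j < T i2 j) ∧
      (∀ i j, ¬ j < lam i → T i j = 0) ∧
      ∀ e < m, ∑ i ∈ range m, ((range (lam i)).filter fun j => T i j = e).card = α e := by
  induction m with
  | zero =>
    intro lam α _ h0 _ _
    refine ⟨fun _ _ => 0, ?_, ?_, ?_, ?_, ?_⟩ <;> intros <;> simp_all
  | succ m ih =>
    intro lam α hl h0 hS hT
    set k := α m with hk
    have hk0 : k ≤ lam 0 := by simpa using hS {m} (by simp)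
    have hkm : lam m ≤ k := by
      have := hS (range m) (by simp)
      rw [Finset.card_range] at this
      rw [Finset.sum_range_succ, Finset.sum_range_succ] at hT
      omega
    have hstep : ∀ i, lam (i + 1) ≤ lam i := fun i => hl (Nat.le_succ i)
    obtain ⟨mu, hmu⟩ : ∃ mu : ℕ → ℕ, ∀ i, mu i = lam i - min k (lam i) + min k (lam (i + 1)) :=
      ⟨_, fun i => rfl⟩
    have htel : ∀ n, (∑ i ∈ range n, mu i) + k = (∑ i ∈ range n, lam i) + min k (lam n) := by
      intro n
      rw [← telesc lam hl k hk0 n]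
      simp [hmu]
    have hle : ∀ i, mu i ≤ lam i := by
      intro i; have := hstep i; rw [hmu]; omega
    have hge : ∀ i, lam (i + 1) ≤ mu i := by
      intro i; have := hstep i; rw [hmu]; omega
    have hma : Antitone mu := antitone_nat_of_succ_le fun i => (hle _).trans (hge _)
    have hm0 : ∀ i, m ≤ i → mu i = 0 := by
      intro i hi
      have h1 := h0 (i + 1) (by omega)
      have h2 := hl hi
      rw [hmu, h1]; omega
    have hmS : ∀ S ⊆ range m, ∑ i ∈ S, α i ≤ ∑ i ∈ range S.card, mu i := by
      intro S hSm
      have h1 := hS S (hSm.trans (by simp))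
      have hn : m ∉ S := fun hc => by simpa using hSm hc
      have h2 := hS (insert m S) (by
        intro x hx
        rcases Finset.mem_insert.1 hx with rfl | hx
        · simp
        · have := Finset.mem_range.1 (hSm hx)
          simp; omega)
      rw [Finset.sum_insert hn, Finset.card_insert_of_notMem hn, Finset.sum_range_succ] at h2
      have := htel S.card
      omega
    have hmT : ∑ i ∈ range m, α i = ∑ i ∈ range m, mu i := by
      have := htel m
      rw [Finset.sum_range_succ, Finset.sum_range_succ] at hT
      omega
    obtain ⟨T, hT1, hT2, hT3, hT4, hT5⟩ := ih mu α hma hm0 hmS hmT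
    refine ⟨fun i j => if j < mu i then T i j else if j < lam i then m else 0, ?_, ?_, ?_, ?_, ?_⟩
    · intro i j hj
      dsimp only
      split_ifs with h1
      · have := hT1 i j h1; omega
      · omega
    · intro i j1 j2 hj hj2
      dsimp only
      have hj1 : j1 < lam i := by omega
      by_cases h2 : j2 < mu i
      · have h1 : j1 < mu i := by omega
        simp only [h1, h2, if_true]
        exact hT2 i j1 j2 hj h2
      · simp only [h2, hj2, hj1, if_true, if_false]
        split_ifs with h1
        · exact (hT1 i j1 h1).le
        · exact le_rfl
    · intro i1 i2 j hi hj
      dsimp only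
      have hA : j < mu i1 := lt_of_lt_of_le hj ((hl hi).trans (hge i1))
      by_cases h2 : j < mu i2
      · simp only [hA, h2, if_true]
        exact hT3 i1 i2 j hi h2
      · simp only [hA, h2, hj, if_true, if_false]
        exact hT1 i1 j hA
    · intro i j hj
      have := hle i
      have h1 : ¬ j < mu i := by omega
      simp [h1, hj]
    · intro e he
      by_cases hem : e < m
      · have key : ∀ i, ((range (lam i)).filter fun j =>
            (if j < mu i then T i j else if j < lam i then m else 0) = e)
            = (range (mu i)).filter fun j => T i j = e := by
          intro i
          ext j
          have := hle i
          simp only [Finset.mem_filter, Finset.mem_range]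
          constructor
          · rintro ⟨h1, h2⟩
            by_cases h3 : j < mu i
            · simp only [h3, if_true] at h2
              exact ⟨h3, h2⟩
            · simp only [h3, h1, if_true, if_false] at h2
              omega
          · rintro ⟨h1, h2⟩
            simp only [h1, if_true]
            exact ⟨by omega, h2⟩
        simp only [key]
        rw [Finset.sum_range_succ, hT5 e hem, hm0 m le_rfl]
        simp
      · have hem' : e = m := by omega
        subst hem'
        have key : ∀ i, ((range (lam i)).filter fun j =>
            (if j < mu i then T i j else if j < lam i then e else 0) = e)
            = range (lam i) \ range (mu i) := by
          intro i
          ext j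
          simp only [Finset.mem_filter, Finset.mem_range, Finset.mem_sdiff]
          constructor
          · rintro ⟨h1, h2⟩
            refine ⟨h1, fun h3 => ?_⟩
            simp only [h3, if_true] at h2
            have := hT1 i j h3
            omega
          · rintro ⟨h1, h2⟩
            simp [h1, h2]
        simp only [key]
        have hc : ∀ i, (range (lam i) \ range (mu i)).card + mu i = lam i := by
          intro i
          rw [Finset.card_sdiff_of_subset (by simpa using hle i)]
          have := hle i
          simp; omega
        have hsum : ∑ i ∈ range (e + 1), (range (lam i) \ range (mu i)).card
            + ∑ i ∈ range (e + 1), mu i = ∑ i ∈ range (e + 1), lam i := by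
          rw [← Finset.sum_add_distrib]
          exact Finset.sum_congr rfl fun i _ => hc i
        have h1 := htel (e + 1)
        have h2 := h0 (e + 1) le_rfl
        rw [h2] at h1
        omega

lemma sum_le_top (L : ℕ → ℕ) (hL : Antitone L) (S : Finset ℕ) :
    ∑ i ∈ S, L i ≤ ∑ i ∈ range S.card, L i := by
  induction S using Finset.induction_on_max with
  | empty => simp
  | insert a s ha ih =>
    have hn : a ∉ s := fun hc => lt_irrefl _ (ha a hc)
    rw [Finset.sum_insert hn, Finset.card_insert_of_notMem hn, Finset.sum_range_succ]
    have : s.card ≤ a := by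
      have h1 : s ⊆ range a := fun x hx => Finset.mem_range.2 (ha x hx)
      simpa using Finset.card_le_card h1
    have := hL this
    omega

lemma sum_range_extz {m : ℕ} (lam : Fin m → ℕ) : ∑ i ∈ range m, extz lam i = ∑ i, lam i := by
  rw [Finset.sum_range]
  simp [extz_fin]

lemma sum_map_extz {m : ℕ} (lam : Fin m → ℕ) (S : Finset (Fin m)) :
    ∑ i ∈ S.map Fin.valEmbedding, extz lam i = ∑ i ∈ S, lam i := by
  rw [Finset.sum_map]
  simp [extz_fin]

/-- Number of entries of a tableau lying in a set. -/
lemma tab_bound {m : ℕ} (lam : Fin m → ℕ) (h : Antitone lam)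
    (T : SemistandardYoungTableau (diagramOf lam h)) (S : Finset ℕ) :
    ((diagramOf lam h).cells.filter fun c => T c.1 c.2 ∈ S).card
      ≤ ∑ i ∈ range S.card, extz lam i := by
  have h1 := card_cells_filter lam h (fun c => c.1 < S.card) S.card (fun i j _ hp => hp)
  have h2 : ∑ i ∈ range S.card, ((range (extz lam i)).filter fun _ => i < S.card).card
      = ∑ i ∈ range S.card, extz lam i := by
    refine Finset.sum_congr rfl fun i hi => ?_
    simp [Finset.mem_range.1 hi]
  rw [← h2, ← h1]
  have hst : ∀ i1 i2 j, i1 < i2 → T i1 j ∈ S →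
      ((range i1).filter fun i' => T i' j ∈ S).card
        < ((range i2).filter fun i' => T i' j ∈ S).card := by
    intro i1 i2 j hi hm
    refine Finset.card_lt_card ⟨?_, ?_⟩
    · intro x hx
      simp only [Finset.mem_filter, Finset.mem_range] at hx ⊢
      exact ⟨by omega, hx.2⟩
    · intro hsub
      have : i1 ∈ (range i1).filter fun i' => T i' j ∈ S :=
        hsub (by simp only [Finset.mem_filter, Finset.mem_range]; exact ⟨hi, hm⟩)
      simp at this
  refine Finset.card_le_card_of_injOn
    (fun c => (((range c.1).filter fun i' => T i' c.2 ∈ S).card, c.2)) ?_ ?_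
  · rintro ⟨i, j⟩ hc
    simp only [Finset.coe_filter, YoungDiagram.mem_cells, Set.mem_setOf_eq] at hc ⊢
    obtain ⟨hc1, hc2⟩ := hc
    constructor
    · refine (diagramOf lam h).up_left_mem ?_ le_rfl hc1
      exact (Finset.card_filter_le _ _).trans (by simp)
    · have : ((range i).filter fun i' => T i' j ∈ S).card ≤ (S.erase (T i j)).card := by
        refine Finset.card_le_card_of_injOn (fun i' => T i' j) ?_ ?_
        · intro x hx
          simp only [Finset.coe_filter, Finset.mem_range, Set.mem_setOf_eq] at hx
          simp only [Finset.coe_erase, Set.mem_diff, Set.mem_singleton_iff, Finset.mem_coe]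
          exact ⟨hx.2, (T.col_strict hx.1 hc1).ne⟩
        · intro x hx y hy hxy
          simp only [Finset.coe_filter, Finset.mem_range, Set.mem_setOf_eq] at hx hy
          dsimp only at hxy
          have hcx := (diagramOf lam h).up_left_mem hx.1.le le_rfl hc1
          have hcy := (diagramOf lam h).up_left_mem hy.1.le le_rfl hc1
          rcases lt_trichotomy x y with hlt | heq | hlt
          · have := T.col_strict hlt hcy; omega
          · exact heq
          · have := T.col_strict hlt hcx; omega
      exact lt_of_le_of_lt this (Finset.card_erase_lt_of_mem hc2)
  · rintro ⟨i1, j1⟩ hc1 ⟨i2, j2⟩ hc2 heq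
    simp only [Finset.coe_filter, YoungDiagram.mem_cells, Set.mem_setOf_eq] at hc1 hc2
    simp only [Prod.mk.injEq] at heq
    obtain ⟨he, rfl⟩ := heq
    rcases lt_trichotomy i1 i2 with hlt | heq | hlt
    · have := hst i1 i2 j1 hlt hc1.2; omega
    · rw [heq]
    · have := hst i2 i1 j1 hlt hc2.2; omega

/-- The permutohedron by inequalities. -/
def permQ {m : ℕ} (lam : Fin m → ℕ) : Set (Fin m → ℝ) :=
  {x | (∀ i, 0 ≤ x i) ∧
    (∀ S : Finset (Fin m), ∑ i ∈ S, x i ≤ ((∑ i ∈ range S.card, extz lam i : ℕ) : ℝ)) ∧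
    ∑ i, x i = ((∑ i ∈ range m, extz lam i : ℕ) : ℝ)}

lemma permQ_convex {m : ℕ} (lam : Fin m → ℕ) : Convex ℝ (permQ lam) := by
  rintro x ⟨hx0, hx1, hx2⟩ y ⟨hy0, hy1, hy2⟩ a b ha hb hab
  refine ⟨fun i => ?_, fun S => ?_, ?_⟩
  · have := mul_nonneg ha (hx0 i)
    have := mul_nonneg hb (hy0 i)
    simp only [Pi.add_apply, Pi.smul_apply, smul_eq_mul]
    linarith
  · simp only [Pi.add_apply, Pi.smul_apply, smul_eq_mul, Finset.sum_add_distrib, ← Finset.mul_sum]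
    have h1 := mul_le_mul_of_nonneg_left (hx1 S) ha
    have h2 := mul_le_mul_of_nonneg_left (hy1 S) hb
    have h3 : a * ((∑ i ∈ range S.card, extz lam i : ℕ) : ℝ)
      + b * ((∑ i ∈ range S.card, extz lam i : ℕ) : ℝ)
      = ((∑ i ∈ range S.card, extz lam i : ℕ) : ℝ) := by rw [← add_mul, hab, one_mul]
    linarith
  · simp only [Pi.add_apply, Pi.smul_apply, smul_eq_mul, Finset.sum_add_distrib, ← Finset.mul_sum]
    rw [hx2, hy2, ← add_mul, hab, one_mul]

lemma schur_ne_zero_iff {m : ℕ} (lam : Fin m → ℕ) (h : Antitone lam) (α : Fin m → ℕ) :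
    schurR m (diagramOf lam h) α ≠ 0 ↔ (fun i => (α i : ℝ)) ∈ permQ lam := by
  have hfin : Finite {T : SemistandardYoungTableau (diagramOf lam h) //
      (∀ i j : ℕ, (i, j) ∈ diagramOf lam h → T i j < m) ∧
      ∀ k : Fin m, content (diagramOf lam h) T (k : ℕ) = α k} := by
    refine Finite.of_injective (β := ((diagramOf lam h).cells → Fin m))
      (fun T c => ⟨T.1 c.1.1 c.1.2, T.2.1 _ _ ((YoungDiagram.mem_cells _).1 c.2)⟩) ?_
    intro T T' hTT
    apply Subtype.ext
    apply SemistandardYoungTableau.ext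
    intro i j
    by_cases hc : (i, j) ∈ diagramOf lam h
    · have := congrFun hTT ⟨(i, j), (YoungDiagram.mem_cells _).2 hc⟩
      simpa using this
    · rw [T.1.zeros hc, T'.1.zeros hc]
  have h1 : schurR m (diagramOf lam h) α ≠ 0 ↔
      Nonempty {T : SemistandardYoungTableau (diagramOf lam h) //
      (∀ i j : ℕ, (i, j) ∈ diagramOf lam h → T i j < m) ∧
      ∀ k : Fin m, content (diagramOf lam h) T (k : ℕ) = α k} := by
    simp only [schurR, schurCoeff, ne_eq, Nat.cast_eq_zero]
    rw [← ne_eq, Nat.card_ne_zero]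
    exact ⟨fun hh => hh.1, fun hh => ⟨hh, hfin⟩⟩
  rw [h1]
  have hQ : (fun i => (α i : ℝ)) ∈ permQ lam ↔
      (∀ S : Finset (Fin m), ∑ i ∈ S, α i ≤ ∑ i ∈ range S.card, extz lam i) ∧
      ∑ i, α i = ∑ i ∈ range m, extz lam i := by
    simp only [permQ, Set.mem_setOf_eq]
    constructor
    · rintro ⟨_, ha, hb⟩
      exact ⟨fun S => by exact_mod_cast ha S, by exact_mod_cast hb⟩
    · rintro ⟨ha, hb⟩
      exact ⟨fun i => by positivity, fun S => by exact_mod_cast ha S, by exact_mod_cast hb⟩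
  rw [hQ]
  constructor
  · rintro ⟨T, hT1, hT2⟩
    have hcount : ∀ S : Finset (Fin m), ∑ i ∈ S, α i =
        ((diagramOf lam h).cells.filter fun c => T c.1 c.2 ∈ S.map Fin.valEmbedding).card := by
      intro S
      rw [Finset.card_eq_sum_card_fiberwise (f := fun c => T c.1 c.2)
        (t := S.map Fin.valEmbedding) (by
          intro c hc
          simpa using (Finset.mem_filter.1 hc).2)]
      rw [Finset.sum_map]
      refine Finset.sum_congr rfl fun k hk => ?_
      rw [← hT2 k, content, Finset.filter_filter]
      congr 1
      refine Finset.filter_congr fun c _ => ?_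
      constructor
      · intro hc
        refine ⟨?_, hc⟩
        rw [hc]
        exact Finset.mem_map_of_mem _ hk
      · exact fun hc => hc.2
    constructor
    · intro S
      rw [hcount S]
      simpa using tab_bound lam h T (S.map Fin.valEmbedding)
    · rw [hcount univ, card_cells_filter lam h _ m]
      · refine Finset.sum_congr rfl fun i _ => ?_
        rw [Finset.filter_true_of_mem, Finset.card_range]
        intro j hj
        have := hT1 i j ((mem_diagramOf lam h i j).2 (Finset.mem_range.1 hj))
        exact Finset.mem_map.2 ⟨⟨_, this⟩, Finset.mem_univ _, rfl⟩
      · intro i j hj _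
        by_contra hc
        rw [extz_ge lam (by omega)] at hj
        omega
  · rintro ⟨ha, hb⟩
    obtain ⟨T, hT1, hT2, hT3, hT4, hT5⟩ := exists_tab m (extz lam) (extz α) (extz_anti lam h)
      (fun i hi => extz_ge lam hi) (by
        intro S hS
        have hSm : S = (univ.filter fun i : Fin m => (i : ℕ) ∈ S).map Fin.valEmbedding := by
          ext x
          simp only [Finset.mem_map, Finset.mem_filter, Finset.mem_univ, true_and]
          constructor
          · intro hx
            exact ⟨⟨x, Finset.mem_range.1 (hS hx)⟩, hx, rfl⟩
          · rintro ⟨a, ha, rfl⟩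
            exact ha
        rw [hSm, sum_map_extz, Finset.card_map]
        exact ha _) (by rw [sum_range_extz, hb])
    refine ⟨⟨⟨T, ?_, ?_, ?_⟩, ?_, ?_⟩⟩
    · intro i j1 j2 hj hc
      exact hT2 i j1 j2 hj ((mem_diagramOf lam h _ _).1 hc)
    · intro i1 i2 j hi hc
      exact hT3 i1 i2 j hi ((mem_diagramOf lam h _ _).1 hc)
    · intro i j hc
      exact hT4 i j (fun hh => hc ((mem_diagramOf lam h _ _).2 hh))
    · intro i j hc
      exact hT1 i j ((mem_diagramOf lam h _ _).1 hc)
    · intro k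
      rw [content, card_cells_filter lam h _ m]
      · rw [← extz_fin α k, ← hT5 k k.2]
        rfl
      · intro i j hj _
        by_contra hc
        rw [extz_ge lam (by omega)] at hj
        omega

lemma abel_ge (c d : ℕ → ℝ) (n : ℕ) (hc : ∀ i < n, c (i + 1) ≤ c i)
    (hd : ∀ k ≤ n, 0 ≤ ∑ i ∈ range k, d i) :
    c n * ∑ i ∈ range (n + 1), d i ≤ ∑ i ∈ range (n + 1), c i * d i := by
  induction n with
  | zero => simp
  | succ n ih =>
    have h1 := ih (fun i hi => hc i (by omega)) (fun k hk => hd k (by omega))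
    rw [Finset.sum_range_succ, Finset.sum_range_succ (fun i => c i * d i)]
    have h2 := mul_le_mul_of_nonneg_right (hc n (by omega)) (hd (n + 1) le_rfl)
    rw [mul_add]
    linarith

lemma permQ_le {m : ℕ} (lam : Fin m → ℕ) (x : Fin m → ℝ) (hx : x ∈ permQ lam) (c : Fin m → ℝ) :
    ∃ σ : Equiv.Perm (Fin m), ∑ i, c i * x i ≤ ∑ i, c i * (lam (σ i) : ℝ) := by
  obtain ⟨_, hx1, hx2⟩ := hx
  obtain ⟨n, rfl⟩ | rfl : (∃ n, m = n + 1) ∨ m = 0 := by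
    cases m with
    | zero => right; rfl
    | succ n => left; exact ⟨n, rfl⟩
  swap
  · exact ⟨1, by simp⟩
  set τ : Equiv.Perm (Fin (n + 1)) := Tuple.sort (fun i => - c i) with hτ
  have hmono : Monotone ((fun i => - c i) ∘ τ) := Tuple.monotone_sort _
  refine ⟨τ.symm, ?_⟩
  rw [← Equiv.sum_comp τ, ← Equiv.sum_comp τ (fun i => c i * (lam (τ.symm i) : ℝ))]
  simp only [Equiv.symm_apply_apply]
  let C : ℕ → ℝ := fun i => if h : i < n + 1 then c (τ ⟨i, h⟩) else 0
  let X : ℕ → ℝ := fun i => if h : i < n + 1 then x (τ ⟨i, h⟩) else 0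
  have hXs : ∀ k ≤ n + 1, ∑ i ∈ range k, X i ≤ ((∑ i ∈ range k, extz lam i : ℕ) : ℝ) := by
    intro k hk
    have := hx1 ((univ : Finset (Fin k)).map ((Fin.castLEEmb hk).trans τ.toEmbedding))
    rw [Finset.card_map, Finset.card_univ, Fintype.card_fin, Finset.sum_map] at this
    refine le_trans (le_of_eq ?_) this
    rw [Finset.sum_range]
    refine Finset.sum_congr rfl fun i _ => ?_
    have : (i : ℕ) < n + 1 := by omega
    simp only [X, this, dif_pos]
    rfl
  have hXt : ∑ i ∈ range (n + 1), X i = ((∑ i ∈ range (n + 1), extz lam i : ℕ) : ℝ) := by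
    rw [← hx2, ← Equiv.sum_comp τ, Finset.sum_range]
    refine Finset.sum_congr rfl fun i _ => ?_
    simp only [X, i.isLt, dif_pos]
  have := abel_ge C (fun i => (extz lam i : ℝ) - X i) n (by
    intro i hi
    have h1 : i < n + 1 := by omega
    have h2 : i + 1 < n + 1 := by omega
    simp only [C, h1, h2, dif_pos]
    have := @hmono ⟨i, h1⟩ ⟨i + 1, h2⟩ (by simp [Fin.le_def])
    simpa using this) (by
    intro k hk
    rw [Finset.sum_sub_distrib]
    have := hXs k (by omega)
    push_cast at this
    linarith)
  rw [Finset.sum_sub_distrib, hXt] at this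
  push_cast at this
  rw [sub_self, mul_zero] at this
  simp only [mul_sub, Finset.sum_sub_distrib] at this
  have e1 : ∑ i ∈ range (n + 1), C i * (extz lam i : ℝ) = ∑ i, c (τ i) * (lam i : ℝ) := by
    rw [Finset.sum_range]
    refine Finset.sum_congr rfl fun i _ => ?_
    simp only [C, i.isLt, dif_pos, extz_fin]
  have e2 : ∑ i ∈ range (n + 1), C i * X i = ∑ i, c (τ i) * x (τ i) := by
    rw [Finset.sum_range]
    refine Finset.sum_congr rfl fun i _ => ?_
    simp only [C, X, i.isLt, dif_pos]
  rw [e1, e2] at this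
  linarith

lemma permQ_sub {m : ℕ} (lam : Fin m → ℕ) : permQ lam ⊆ convexHull ℝ (orbitR lam) := by
  intro x hx
  by_contra hn
  have hfin : (orbitR lam).Finite := by
    have : orbitR lam = Set.range fun σ : Equiv.Perm (Fin m) => fun i => (lam (σ i) : ℝ) := by
      ext y
      simp only [orbitR, Set.mem_setOf_eq, Set.mem_range]
      exact ⟨fun ⟨s, hs⟩ => ⟨s, hs.symm⟩, fun ⟨s, hs⟩ => ⟨s, hs.symm⟩⟩
    rw [this]
    exact Set.finite_range _
  obtain ⟨f, u, hf1, hf2⟩ := geometric_hahn_banach_closed_point (convex_convexHull ℝ (orbitR lam))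
    (hfin.isClosed_convexHull (𝕜 := ℝ)) hn
  have hrep : ∀ y : Fin m → ℝ, f y = ∑ i, f (Pi.single i 1) * y i := by
    intro y
    conv_lhs => rw [pi_eq_sum_univ' y]
    rw [map_sum]
    refine Finset.sum_congr rfl fun i _ => ?_
    rw [map_smul, smul_eq_mul, mul_comm]
  obtain ⟨σ, hσ⟩ := permQ_le lam x hx (fun i => f (Pi.single i 1))
  rw [← hrep x, ← hrep (fun i => (lam (σ i) : ℝ))] at hσ
  have := hf1 _ (subset_convexHull ℝ _ ⟨σ, rfl⟩)
  linarith

lemma orbit_sub {m : ℕ} (lam : Fin m → ℕ) (h : Antitone lam) (σ : Equiv.Perm (Fin m)) :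
    (fun i => (lam (σ i) : ℝ)) ∈ permQ lam := by
  refine ⟨fun i => by positivity, fun S => ?_, ?_⟩
  · have := sum_le_top (extz lam) (extz_anti lam h)
      (S.map (σ.toEmbedding.trans Fin.valEmbedding))
    rw [Finset.card_map, Finset.sum_map] at this
    simp only [Function.Embedding.trans_apply, Equiv.coe_toEmbedding, Fin.valEmbedding_apply,
      extz_fin] at this
    beta_reduce
    exact_mod_cast this
  · rw [sum_range_extz, ← Equiv.sum_comp σ lam]
    push_cast
    rfl

/-- Schur polynomials have saturated Newton polytope, and the Newton polytope of `s_λ` is the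
convex hull of the `S_m`-orbit of `λ`. -/
theorem schur_snp_and_newton_eq_orbit (m : ℕ) (lam : Fin m → ℕ) (h : Antitone lam) :
    HasSNP (schurR m (diagramOf lam h)) ∧
      NewtonP (schurR m (diagramOf lam h)) = convexHull ℝ (orbitR lam) := by
  have hsupp : Supp (schurR m (diagramOf lam h)) = permQ lam ∩ {x | IsLattice x} := by
    ext x
    simp only [Supp, Set.mem_setOf_eq, Set.mem_inter_iff]
    constructor
    · rintro ⟨α, ha, rfl⟩
      exact ⟨(schur_ne_zero_iff lam h α).1 ha, fun i => ⟨(α i : ℤ), by simp⟩⟩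
    · rintro ⟨hx, hlat⟩
      choose z hz using hlat
      have hzn : ∀ i, 0 ≤ z i := fun i => by
        have := hx.1 i
        rw [hz i] at this
        exact_mod_cast this
      have hxe : x = fun i => (((z i).toNat : ℕ) : ℝ) := by
        funext i
        rw [hz i]
        have := Int.toNat_of_nonneg (hzn i)
        exact_mod_cast this.symm
      refine ⟨fun i => (z i).toNat, ?_, hxe⟩
      rw [schur_ne_zero_iff, ← hxe]
      exact hx
  have hN1 : NewtonP (schurR m (diagramOf lam h)) ⊆ permQ lam := by
    refine convexHull_min ?_ (permQ_convex lam)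
    rw [hsupp]
    exact Set.inter_subset_left
  refine ⟨?_, ?_⟩
  · refine Set.Subset.antisymm ?_ ?_
    · rw [hsupp]
      exact Set.inter_subset_inter_left _ hN1
    · intro x hx
      refine ⟨subset_convexHull ℝ _ hx, ?_⟩
      rw [hsupp] at hx
      exact hx.2
  · refine Set.Subset.antisymm (hN1.trans (permQ_sub lam)) ?_
    refine convexHull_mono ?_
    rintro x ⟨σ, rfl⟩
    exact ⟨fun i => lam (σ i), (schur_ne_zero_iff lam h _).2 (orbit_sub lam h σ), rfl⟩
end

section
/- The polynomial F = s_{(6,4,0)} + s_{(6,4,1)} + s_{(6,4,2)} + s_{(6,4,3)} + s_{(6,5,3)} + s_{(6,6,3)} in three variables does not have saturated Newton polytope: the point (6,5,2) lies in Newton(F) ∩ Z^3 but not in Supp(F). -/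
open Finset Pointwise

theorem entry_finite (μ : YoungDiagram) (α : Fin 3 → ℕ) :
    Finite {T : SemistandardYoungTableau μ // (∀ i j : ℕ, (i, j) ∈ μ → T i j < 3) ∧
      ∀ k : Fin 3, content μ T (k : ℕ) = α k} := by
  let f : {T : SemistandardYoungTableau μ // (∀ i j : ℕ, (i, j) ∈ μ → T i j < 3) ∧
      ∀ k : Fin 3, content μ T (k : ℕ) = α k} → (μ.cells → Fin 3) :=
    fun T c => ⟨T.1 c.1.1 c.1.2, T.2.1 _ _ ((YoungDiagram.mem_cells _).1 c.2)⟩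
  apply Finite.of_injective f
  intro T T' h
  apply Subtype.ext
  ext i j
  by_cases hc : (i, j) ∈ μ
  · have := congrFun h ⟨(i, j), (YoungDiagram.mem_cells _).2 hc⟩
    exact congrArg Fin.val this
  · rw [T.1.zeros hc, T'.1.zeros hc]

theorem schurCoeff_pos (μ : YoungDiagram) (α : Fin 3 → ℕ) (T : SemistandardYoungTableau μ)
    (h1 : ∀ i j : ℕ, (i, j) ∈ μ → T i j < 3) (h2 : ∀ k : Fin 3, content μ T (k : ℕ) = α k) :
    0 < schurCoeff 3 μ α := by
  have := entry_finite μ α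
  unfold schurCoeff
  have : Nonempty {T : SemistandardYoungTableau μ // (∀ i j : ℕ, (i, j) ∈ μ → T i j < 3) ∧
      ∀ k : Fin 3, content μ T (k : ℕ) = α k} := ⟨⟨T, h1, h2⟩⟩
  exact Nat.card_pos

theorem mem_diagramOf_three (lam : Fin 3 → ℕ) (h : Antitone lam) (i j : ℕ)
    (hij : (i, j) ∈ diagramOf lam h) : i < 3 := by
  rw [← YoungDiagram.mem_cells] at hij
  simp only [diagramOf, Finset.mem_biUnion, Finset.mem_image, Prod.mk.injEq] at hij
  obtain ⟨a, -, b, -, hab, -⟩ := hij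
  omega

theorem schurCoeff_self_pos (lam : Fin 3 → ℕ) (h : Antitone lam)
    (hc : ∀ k : Fin 3, ((diagramOf lam h).cells.filter fun c => c.1 = (k : ℕ)).card = lam k) :
    0 < schurCoeff 3 (diagramOf lam h) lam := by
  apply schurCoeff_pos _ _ (SemistandardYoungTableau.highestWeight _)
  · intro i j hij
    rw [SemistandardYoungTableau.highestWeight_apply, if_pos hij]
    exact mem_diagramOf_three lam h i j hij
  · intro k
    rw [← hc k]
    unfold content
    congr 1
    apply Finset.filter_congr
    rintro ⟨i, j⟩ hij
    rw [SemistandardYoungTableau.highestWeight_apply,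
      if_pos ((YoungDiagram.mem_cells _).1 hij)]

theorem schurCoeff_eq_zero_of_card (μ : YoungDiagram) (α : Fin 3 → ℕ)
    (h : μ.cells.card ≠ α 0 + α 1 + α 2) : schurCoeff 3 μ α = 0 := by
  unfold schurCoeff
  rw [Nat.card_eq_zero]
  left
  constructor
  rintro ⟨T, h1, h2⟩
  apply h
  rw [Finset.card_eq_sum_card_fiberwise (f := fun c => T c.1 c.2) (t := Finset.range 3)]
  · have a0 := h2 0
    have a1 := h2 1
    have a2 := h2 2
    simp only [Finset.sum_range_succ, Finset.sum_range_zero, zero_add]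
    rw [← a0, ← a1, ← a2]
    rfl
  · rintro ⟨i, j⟩ hc
    simpa using h1 i j ((YoungDiagram.mem_cells _).1 hc)

theorem schurCoeff_eq_zero_of_row (μ : YoungDiagram) (α : Fin 3 → ℕ)
    (hr : α 2 < (μ.cells.filter fun c => c.1 = 2).card) : schurCoeff 3 μ α = 0 := by
  unfold schurCoeff
  rw [Nat.card_eq_zero]
  left
  constructor
  rintro ⟨T, h1, h2⟩
  have a2 := h2 2
  apply absurd hr
  rw [not_lt, ← a2]
  apply Finset.card_le_card
  rintro ⟨i, j⟩ hc
  rw [Finset.mem_filter] at hc ⊢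
  obtain ⟨hc, hi⟩ := hc
  refine ⟨hc, ?_⟩
  simp only at hi
  subst hi
  have hm := (YoungDiagram.mem_cells _).1 hc
  have b1 := T.col_strict (show 1 < 2 by norm_num) hm
  have b0 := T.col_strict (show 0 < 1 by norm_num) (μ.up_left_mem (by norm_num) le_rfl hm)
  have b2 := h1 _ _ hm
  change T 2 j = 2
  omega

/-- `F = s_{(6,4,0)} + s_{(6,4,1)} + s_{(6,4,2)} + s_{(6,4,3)} + s_{(6,5,3)} + s_{(6,6,3)}`
does not have saturated Newton polytope: `(6,5,2)` is a lattice point of `Newton(F)` that is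
not in `Supp(F)`. -/
theorem six_five_two_not_snp :
    ∀ F : (Fin 3 → ℕ) → ℝ,
      F = (fun α =>
        (schurCoeff 3 (diagramOf ![6,4,0] (by decide)) α : ℝ) +
        (schurCoeff 3 (diagramOf ![6,4,1] (by decide)) α : ℝ) +
        (schurCoeff 3 (diagramOf ![6,4,2] (by decide)) α : ℝ) +
        (schurCoeff 3 (diagramOf ![6,4,3] (by decide)) α : ℝ) +
        (schurCoeff 3 (diagramOf ![6,5,3] (by decide)) α : ℝ) +
        (schurCoeff 3 (diagramOf ![6,6,3] (by decide)) α : ℝ)) →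
      (fun i => ((![6,5,2] : Fin 3 → ℕ) i : ℝ)) ∈ NewtonP F ∧
      IsLattice (fun i => ((![6,5,2] : Fin 3 → ℕ) i : ℝ)) ∧
      (fun i => ((![6,5,2] : Fin 3 → ℕ) i : ℝ)) ∉ Supp F ∧
      ¬ HasSNP F := by
  intro F hF
  have hN : (fun i => ((![6,5,2] : Fin 3 → ℕ) i : ℝ)) ∈ NewtonP F := by
    have p1 : (fun i => ((![6,4,1] : Fin 3 → ℕ) i : ℝ)) ∈ Supp F := by
      refine ⟨![6,4,1], ?_, rfl⟩
      have := schurCoeff_self_pos ![6,4,1] (by decide) (by decide)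
      subst hF
      have : (0 : ℝ) < schurCoeff 3 (diagramOf ![6,4,1] (by decide)) ![6,4,1] := by
        exact_mod_cast this
      apply ne_of_gt
      positivity
    have p2 : (fun i => ((![6,6,3] : Fin 3 → ℕ) i : ℝ)) ∈ Supp F := by
      refine ⟨![6,6,3], ?_, rfl⟩
      have := schurCoeff_self_pos ![6,6,3] (by decide) (by decide)
      subst hF
      have : (0 : ℝ) < schurCoeff 3 (diagramOf ![6,6,3] (by decide)) ![6,6,3] := by
        exact_mod_cast this
      apply ne_of_gt
      positivity
    have := (convex_convexHull ℝ (Supp F)) (subset_convexHull ℝ _ p1)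
      (subset_convexHull ℝ _ p2) (show (0 : ℝ) ≤ 1 / 2 by norm_num)
      (show (0 : ℝ) ≤ 1 / 2 by norm_num) (by norm_num)
    unfold NewtonP
    convert this using 1
    ext i
    fin_cases i <;> simp <;> norm_num
  have hL : IsLattice (fun i => ((![6,5,2] : Fin 3 → ℕ) i : ℝ)) :=
    fun i => ⟨((![6,5,2] : Fin 3 → ℕ) i : ℤ), by push_cast; rfl⟩
  have hS : (fun i => ((![6,5,2] : Fin 3 → ℕ) i : ℝ)) ∉ Supp F := by
    rintro ⟨α, hα, he⟩
    have e : α = ![6,5,2] := by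
      ext i
      have := congrFun he i
      exact_mod_cast this.symm
    subst e
    apply hα
    subst hF
    simp only
    rw [schurCoeff_eq_zero_of_card (diagramOf ![6,4,0] _) _ (by decide),
      schurCoeff_eq_zero_of_card (diagramOf ![6,4,1] _) _ (by decide),
      schurCoeff_eq_zero_of_card (diagramOf ![6,4,2] _) _ (by decide),
      schurCoeff_eq_zero_of_row (diagramOf ![6,4,3] _) _ (by decide),
      schurCoeff_eq_zero_of_card (diagramOf ![6,5,3] _) _ (by decide),
      schurCoeff_eq_zero_of_card (diagramOf ![6,6,3] _) _ (by decide)]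
    norm_num
  refine ⟨hN, hL, hS, fun h => hS ?_⟩
  unfold HasSNP at h
  rw [← h]
  exact ⟨hN, hL⟩
end
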